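/- In the polynomial ring Q[c4, c6, lam, mu] the identity bC4(lam,mu)^3 - bC6(lam,mu)^2 = (c4^3 - c6^2)^2 * bD(lam,mu)^5 holds. -/

import Mathlib

open MvPolynomial

set_option maxHeartbeats 1000000 in
/-- The polynomial `𝐃(λ,μ)` in `ℚ[c4, c6, λ, μ]`, with `c4 = X 0`, `c6 = X 1`,
`λ = X 2`, `μ = X 3`. -/
noncomputable def bD : MvPolynomial (Fin 4) ℚ :=
  -((125 * X 0 ^ 3 + 64 * X 1 ^ 2) * X 2 ^ 12)
    - 1620 * X 0 ^ 2 * X 1 * X 2 ^ 11 * X 3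
    - 66 * (25 * X 0 ^ 4 + 56 * X 0 * X 1 ^ 2) * X 2 ^ 10 * X 3 ^ 2
    - 220 * (11 * X 0 ^ 3 * X 1 + 16 * X 1 ^ 3) * X 2 ^ 9 * X 3 ^ 3
    + 1485 * (5 * X 0 ^ 5 + 4 * X 0 ^ 2 * X 1 ^ 2) * X 2 ^ 8 * X 3 ^ 4
    + 792 * (53 * X 0 ^ 4 * X 1 + 28 * X 0 * X 1 ^ 3) * X 2 ^ 7 * X 3 ^ 5
    + 660 * (9 * X 0 ^ 6 + 164 * X 0 ^ 3 * X 1 ^ 2 + 16 * X 1 ^ 4) * X 2 ^ 6 * X 3 ^ 6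
    + 2376 * (19 * X 0 ^ 5 * X 1 + 44 * X 0 ^ 2 * X 1 ^ 3) * X 2 ^ 5 * X 3 ^ 7
    + 495 * (27 * X 0 ^ 7 + 104 * X 0 ^ 4 * X 1 ^ 2 + 112 * X 0 * X 1 ^ 4) * X 2 ^ 4 * X 3 ^ 8
    + 220 * (81 * X 0 ^ 6 * X 1 + 136 * X 0 ^ 3 * X 1 ^ 3 + 80 * X 1 ^ 5) * X 2 ^ 3 * X 3 ^ 9
    - 594 * (9 * X 0 ^ 8 - 32 * X 0 ^ 5 * X 1 ^ 2 - 16 * X 0 ^ 2 * X 1 ^ 4) * X 2 ^ 2 * X 3 ^ 10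
    - 60 * (135 * X 0 ^ 7 * X 1 - 328 * X 0 ^ 4 * X 1 ^ 3 + 112 * X 0 * X 1 ^ 5) * X 2 * X 3 ^ 11
    - (729 * X 0 ^ 9 + 108 * X 0 ^ 6 * X 1 ^ 2 - 2896 * X 0 ^ 3 * X 1 ^ 4 + 1600 * X 1 ^ 6)
        * X 3 ^ 12

/-- The polynomial `𝐂₄(λ,μ) = -(1/(11²·12²)) (𝐃_λλ 𝐃_μμ - 𝐃_λμ²)`. -/
noncomputable def bC4 : MvPolynomial (Fin 4) ℚ :=
  C (-(1 / (11 ^ 2 * 12 ^ 2)) : ℚ) *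
    (pderiv 2 (pderiv 2 bD) * pderiv 3 (pderiv 3 bD) - (pderiv 2 (pderiv 3 bD)) ^ 2)

/-- The polynomial `𝐂₆(λ,μ) = -(1/(12·20)) (𝐃_λ (𝐂₄)_μ - 𝐃_μ (𝐂₄)_λ)`. -/
noncomputable def bC6 : MvPolynomial (Fin 4) ℚ :=
  C (-(1 / (12 * 20)) : ℚ) *
    (pderiv 2 bD * pderiv 3 bC4 - pderiv 3 bD * pderiv 2 bC4)

set_option maxHeartbeats 4000000 in
/-- Expanded form of the derivative of `bD`, `0` times in `l` and `0` times in `m`. -/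
def eD {R : Type*} [CommRing R] (a b l m : R) : R :=
    ((-125 * a ^ 3 - 64 * b ^ 2) * l ^ 12 : R)
    + ((-1620 * a ^ 2 * b) * l ^ 11 * m : R)
    + ((-1650 * a ^ 4 - 3696 * a * b ^ 2) * l ^ 10 * m ^ 2 : R)
    + ((-2420 * a ^ 3 * b - 3520 * b ^ 3) * l ^ 9 * m ^ 3 : R)
    + ((7425 * a ^ 5 + 5940 * a ^ 2 * b ^ 2) * l ^ 8 * m ^ 4 : R)
    + ((41976 * a ^ 4 * b + 22176 * a * b ^ 3) * l ^ 7 * m ^ 5 : R)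
    + ((5940 * a ^ 6 + 108240 * a ^ 3 * b ^ 2 + 10560 * b ^ 4) * l ^ 6 * m ^ 6 : R)
    + ((45144 * a ^ 5 * b + 104544 * a ^ 2 * b ^ 3) * l ^ 5 * m ^ 7 : R)
    + ((13365 * a ^ 7 + 51480 * a ^ 4 * b ^ 2 + 55440 * a * b ^ 4) * l ^ 4 * m ^ 8 : R)
    + ((17820 * a ^ 6 * b + 29920 * a ^ 3 * b ^ 3 + 17600 * b ^ 5) * l ^ 3 * m ^ 9 : R)
    + ((-5346 * a ^ 8 + 19008 * a ^ 5 * b ^ 2 + 9504 * a ^ 2 * b ^ 4) * l ^ 2 * m ^ 10 : R)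
    + ((-8100 * a ^ 7 * b + 19680 * a ^ 4 * b ^ 3 - 6720 * a * b ^ 5) * l * m ^ 11 : R)
    + ((-729 * a ^ 9 - 108 * a ^ 6 * b ^ 2 + 2896 * a ^ 3 * b ^ 4 - 1600 * b ^ 6) * m ^ 12 : R)

set_option maxHeartbeats 4000000 in
/-- Expanded form of the derivative of `bD`, `1` times in `l` and `0` times in `m`. -/
def eDl {R : Type*} [CommRing R] (a b l m : R) : R :=
    ((-1500 * a ^ 3 - 768 * b ^ 2) * l ^ 11 : R)
    + ((-17820 * a ^ 2 * b) * l ^ 10 * m : R)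
    + ((-16500 * a ^ 4 - 36960 * a * b ^ 2) * l ^ 9 * m ^ 2 : R)
    + ((-21780 * a ^ 3 * b - 31680 * b ^ 3) * l ^ 8 * m ^ 3 : R)
    + ((59400 * a ^ 5 + 47520 * a ^ 2 * b ^ 2) * l ^ 7 * m ^ 4 : R)
    + ((293832 * a ^ 4 * b + 155232 * a * b ^ 3) * l ^ 6 * m ^ 5 : R)
    + ((35640 * a ^ 6 + 649440 * a ^ 3 * b ^ 2 + 63360 * b ^ 4) * l ^ 5 * m ^ 6 : R)
    + ((225720 * a ^ 5 * b + 522720 * a ^ 2 * b ^ 3) * l ^ 4 * m ^ 7 : R)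
    + ((53460 * a ^ 7 + 205920 * a ^ 4 * b ^ 2 + 221760 * a * b ^ 4) * l ^ 3 * m ^ 8 : R)
    + ((53460 * a ^ 6 * b + 89760 * a ^ 3 * b ^ 3 + 52800 * b ^ 5) * l ^ 2 * m ^ 9 : R)
    + ((-10692 * a ^ 8 + 38016 * a ^ 5 * b ^ 2 + 19008 * a ^ 2 * b ^ 4) * l * m ^ 10 : R)
    + ((-8100 * a ^ 7 * b + 19680 * a ^ 4 * b ^ 3 - 6720 * a * b ^ 5) * m ^ 11 : R)

set_option maxHeartbeats 4000000 in
/-- Expanded form of the derivative of `bD`, `0` times in `l` and `1` times in `m`. -/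
def eDm {R : Type*} [CommRing R] (a b l m : R) : R :=
    ((-1620 * a ^ 2 * b) * l ^ 11 : R)
    + ((-3300 * a ^ 4 - 7392 * a * b ^ 2) * l ^ 10 * m : R)
    + ((-7260 * a ^ 3 * b - 10560 * b ^ 3) * l ^ 9 * m ^ 2 : R)
    + ((29700 * a ^ 5 + 23760 * a ^ 2 * b ^ 2) * l ^ 8 * m ^ 3 : R)
    + ((209880 * a ^ 4 * b + 110880 * a * b ^ 3) * l ^ 7 * m ^ 4 : R)
    + ((35640 * a ^ 6 + 649440 * a ^ 3 * b ^ 2 + 63360 * b ^ 4) * l ^ 6 * m ^ 5 : R)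
    + ((316008 * a ^ 5 * b + 731808 * a ^ 2 * b ^ 3) * l ^ 5 * m ^ 6 : R)
    + ((106920 * a ^ 7 + 411840 * a ^ 4 * b ^ 2 + 443520 * a * b ^ 4) * l ^ 4 * m ^ 7 : R)
    + ((160380 * a ^ 6 * b + 269280 * a ^ 3 * b ^ 3 + 158400 * b ^ 5) * l ^ 3 * m ^ 8 : R)
    + ((-53460 * a ^ 8 + 190080 * a ^ 5 * b ^ 2 + 95040 * a ^ 2 * b ^ 4) * l ^ 2 * m ^ 9 : R)
    + ((-89100 * a ^ 7 * b + 216480 * a ^ 4 * b ^ 3 - 73920 * a * b ^ 5) * l * m ^ 10 : R)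
    + ((-8748 * a ^ 9 - 1296 * a ^ 6 * b ^ 2 + 34752 * a ^ 3 * b ^ 4 - 19200 * b ^ 6) * m ^ 11 : R)

set_option maxHeartbeats 4000000 in
/-- Expanded form of the derivative of `bD`, `2` times in `l` and `0` times in `m`. -/
def eDll {R : Type*} [CommRing R] (a b l m : R) : R :=
    ((-16500 * a ^ 3 - 8448 * b ^ 2) * l ^ 10 : R)
    + ((-178200 * a ^ 2 * b) * l ^ 9 * m : R)
    + ((-148500 * a ^ 4 - 332640 * a * b ^ 2) * l ^ 8 * m ^ 2 : R)
    + ((-174240 * a ^ 3 * b - 253440 * b ^ 3) * l ^ 7 * m ^ 3 : R)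
    + ((415800 * a ^ 5 + 332640 * a ^ 2 * b ^ 2) * l ^ 6 * m ^ 4 : R)
    + ((1762992 * a ^ 4 * b + 931392 * a * b ^ 3) * l ^ 5 * m ^ 5 : R)
    + ((178200 * a ^ 6 + 3247200 * a ^ 3 * b ^ 2 + 316800 * b ^ 4) * l ^ 4 * m ^ 6 : R)
    + ((902880 * a ^ 5 * b + 2090880 * a ^ 2 * b ^ 3) * l ^ 3 * m ^ 7 : R)
    + ((160380 * a ^ 7 + 617760 * a ^ 4 * b ^ 2 + 665280 * a * b ^ 4) * l ^ 2 * m ^ 8 : R)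
    + ((106920 * a ^ 6 * b + 179520 * a ^ 3 * b ^ 3 + 105600 * b ^ 5) * l * m ^ 9 : R)
    + ((-10692 * a ^ 8 + 38016 * a ^ 5 * b ^ 2 + 19008 * a ^ 2 * b ^ 4) * m ^ 10 : R)

set_option maxHeartbeats 4000000 in
/-- Expanded form of the derivative of `bD`, `1` times in `l` and `1` times in `m`. -/
def eDlm {R : Type*} [CommRing R] (a b l m : R) : R :=
    ((-17820 * a ^ 2 * b) * l ^ 10 : R)
    + ((-33000 * a ^ 4 - 73920 * a * b ^ 2) * l ^ 9 * m : R)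
    + ((-65340 * a ^ 3 * b - 95040 * b ^ 3) * l ^ 8 * m ^ 2 : R)
    + ((237600 * a ^ 5 + 190080 * a ^ 2 * b ^ 2) * l ^ 7 * m ^ 3 : R)
    + ((1469160 * a ^ 4 * b + 776160 * a * b ^ 3) * l ^ 6 * m ^ 4 : R)
    + ((213840 * a ^ 6 + 3896640 * a ^ 3 * b ^ 2 + 380160 * b ^ 4) * l ^ 5 * m ^ 5 : R)
    + ((1580040 * a ^ 5 * b + 3659040 * a ^ 2 * b ^ 3) * l ^ 4 * m ^ 6 : R)
    + ((427680 * a ^ 7 + 1647360 * a ^ 4 * b ^ 2 + 1774080 * a * b ^ 4) * l ^ 3 * m ^ 7 : R)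
    + ((481140 * a ^ 6 * b + 807840 * a ^ 3 * b ^ 3 + 475200 * b ^ 5) * l ^ 2 * m ^ 8 : R)
    + ((-106920 * a ^ 8 + 380160 * a ^ 5 * b ^ 2 + 190080 * a ^ 2 * b ^ 4) * l * m ^ 9 : R)
    + ((-89100 * a ^ 7 * b + 216480 * a ^ 4 * b ^ 3 - 73920 * a * b ^ 5) * m ^ 10 : R)

set_option maxHeartbeats 4000000 in
/-- Expanded form of the derivative of `bD`, `0` times in `l` and `2` times in `m`. -/
def eDmm {R : Type*} [CommRing R] (a b l m : R) : R :=
    ((-3300 * a ^ 4 - 7392 * a * b ^ 2) * l ^ 10 : R)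
    + ((-14520 * a ^ 3 * b - 21120 * b ^ 3) * l ^ 9 * m : R)
    + ((89100 * a ^ 5 + 71280 * a ^ 2 * b ^ 2) * l ^ 8 * m ^ 2 : R)
    + ((839520 * a ^ 4 * b + 443520 * a * b ^ 3) * l ^ 7 * m ^ 3 : R)
    + ((178200 * a ^ 6 + 3247200 * a ^ 3 * b ^ 2 + 316800 * b ^ 4) * l ^ 6 * m ^ 4 : R)
    + ((1896048 * a ^ 5 * b + 4390848 * a ^ 2 * b ^ 3) * l ^ 5 * m ^ 5 : R)
    + ((748440 * a ^ 7 + 2882880 * a ^ 4 * b ^ 2 + 3104640 * a * b ^ 4) * l ^ 4 * m ^ 6 : R)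
    + ((1283040 * a ^ 6 * b + 2154240 * a ^ 3 * b ^ 3 + 1267200 * b ^ 5) * l ^ 3 * m ^ 7 : R)
    + ((-481140 * a ^ 8 + 1710720 * a ^ 5 * b ^ 2 + 855360 * a ^ 2 * b ^ 4) * l ^ 2 * m ^ 8 : R)
    + ((-891000 * a ^ 7 * b + 2164800 * a ^ 4 * b ^ 3 - 739200 * a * b ^ 5) * l * m ^ 9 : R)
    + ((-96228 * a ^ 9 - 14256 * a ^ 6 * b ^ 2 + 382272 * a ^ 3 * b ^ 4 - 211200 * b ^ 6) * m ^ 10 : R)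

set_option maxHeartbeats 4000000 in
/-- Expanded form of the derivative of `bD`, `3` times in `l` and `0` times in `m`. -/
def eDlll {R : Type*} [CommRing R] (a b l m : R) : R :=
    ((-165000 * a ^ 3 - 84480 * b ^ 2) * l ^ 9 : R)
    + ((-1603800 * a ^ 2 * b) * l ^ 8 * m : R)
    + ((-1188000 * a ^ 4 - 2661120 * a * b ^ 2) * l ^ 7 * m ^ 2 : R)
    + ((-1219680 * a ^ 3 * b - 1774080 * b ^ 3) * l ^ 6 * m ^ 3 : R)
    + ((2494800 * a ^ 5 + 1995840 * a ^ 2 * b ^ 2) * l ^ 5 * m ^ 4 : R)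
    + ((8814960 * a ^ 4 * b + 4656960 * a * b ^ 3) * l ^ 4 * m ^ 5 : R)
    + ((712800 * a ^ 6 + 12988800 * a ^ 3 * b ^ 2 + 1267200 * b ^ 4) * l ^ 3 * m ^ 6 : R)
    + ((2708640 * a ^ 5 * b + 6272640 * a ^ 2 * b ^ 3) * l ^ 2 * m ^ 7 : R)
    + ((320760 * a ^ 7 + 1235520 * a ^ 4 * b ^ 2 + 1330560 * a * b ^ 4) * l * m ^ 8 : R)
    + ((106920 * a ^ 6 * b + 179520 * a ^ 3 * b ^ 3 + 105600 * b ^ 5) * m ^ 9 : R)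

set_option maxHeartbeats 4000000 in
/-- Expanded form of the derivative of `bD`, `2` times in `l` and `1` times in `m`. -/
def eDllm {R : Type*} [CommRing R] (a b l m : R) : R :=
    ((-178200 * a ^ 2 * b) * l ^ 9 : R)
    + ((-297000 * a ^ 4 - 665280 * a * b ^ 2) * l ^ 8 * m : R)
    + ((-522720 * a ^ 3 * b - 760320 * b ^ 3) * l ^ 7 * m ^ 2 : R)
    + ((1663200 * a ^ 5 + 1330560 * a ^ 2 * b ^ 2) * l ^ 6 * m ^ 3 : R)
    + ((8814960 * a ^ 4 * b + 4656960 * a * b ^ 3) * l ^ 5 * m ^ 4 : R)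
    + ((1069200 * a ^ 6 + 19483200 * a ^ 3 * b ^ 2 + 1900800 * b ^ 4) * l ^ 4 * m ^ 5 : R)
    + ((6320160 * a ^ 5 * b + 14636160 * a ^ 2 * b ^ 3) * l ^ 3 * m ^ 6 : R)
    + ((1283040 * a ^ 7 + 4942080 * a ^ 4 * b ^ 2 + 5322240 * a * b ^ 4) * l ^ 2 * m ^ 7 : R)
    + ((962280 * a ^ 6 * b + 1615680 * a ^ 3 * b ^ 3 + 950400 * b ^ 5) * l * m ^ 8 : R)
    + ((-106920 * a ^ 8 + 380160 * a ^ 5 * b ^ 2 + 190080 * a ^ 2 * b ^ 4) * m ^ 9 : R)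

set_option maxHeartbeats 4000000 in
/-- Expanded form of the derivative of `bD`, `1` times in `l` and `2` times in `m`. -/
def eDlmm {R : Type*} [CommRing R] (a b l m : R) : R :=
    ((-33000 * a ^ 4 - 73920 * a * b ^ 2) * l ^ 9 : R)
    + ((-130680 * a ^ 3 * b - 190080 * b ^ 3) * l ^ 8 * m : R)
    + ((712800 * a ^ 5 + 570240 * a ^ 2 * b ^ 2) * l ^ 7 * m ^ 2 : R)
    + ((5876640 * a ^ 4 * b + 3104640 * a * b ^ 3) * l ^ 6 * m ^ 3 : R)
    + ((1069200 * a ^ 6 + 19483200 * a ^ 3 * b ^ 2 + 1900800 * b ^ 4) * l ^ 5 * m ^ 4 : R)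
    + ((9480240 * a ^ 5 * b + 21954240 * a ^ 2 * b ^ 3) * l ^ 4 * m ^ 5 : R)
    + ((2993760 * a ^ 7 + 11531520 * a ^ 4 * b ^ 2 + 12418560 * a * b ^ 4) * l ^ 3 * m ^ 6 : R)
    + ((3849120 * a ^ 6 * b + 6462720 * a ^ 3 * b ^ 3 + 3801600 * b ^ 5) * l ^ 2 * m ^ 7 : R)
    + ((-962280 * a ^ 8 + 3421440 * a ^ 5 * b ^ 2 + 1710720 * a ^ 2 * b ^ 4) * l * m ^ 8 : R)
    + ((-891000 * a ^ 7 * b + 2164800 * a ^ 4 * b ^ 3 - 739200 * a * b ^ 5) * m ^ 9 : R)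

set_option maxHeartbeats 4000000 in
/-- Expanded form of the derivative of `bD`, `0` times in `l` and `3` times in `m`. -/
def eDmmm {R : Type*} [CommRing R] (a b l m : R) : R :=
    ((-14520 * a ^ 3 * b - 21120 * b ^ 3) * l ^ 9 : R)
    + ((178200 * a ^ 5 + 142560 * a ^ 2 * b ^ 2) * l ^ 8 * m : R)
    + ((2518560 * a ^ 4 * b + 1330560 * a * b ^ 3) * l ^ 7 * m ^ 2 : R)
    + ((712800 * a ^ 6 + 12988800 * a ^ 3 * b ^ 2 + 1267200 * b ^ 4) * l ^ 6 * m ^ 3 : R)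
    + ((9480240 * a ^ 5 * b + 21954240 * a ^ 2 * b ^ 3) * l ^ 5 * m ^ 4 : R)
    + ((4490640 * a ^ 7 + 17297280 * a ^ 4 * b ^ 2 + 18627840 * a * b ^ 4) * l ^ 4 * m ^ 5 : R)
    + ((8981280 * a ^ 6 * b + 15079680 * a ^ 3 * b ^ 3 + 8870400 * b ^ 5) * l ^ 3 * m ^ 6 : R)
    + ((-3849120 * a ^ 8 + 13685760 * a ^ 5 * b ^ 2 + 6842880 * a ^ 2 * b ^ 4) * l ^ 2 * m ^ 7 : R)
    + ((-8019000 * a ^ 7 * b + 19483200 * a ^ 4 * b ^ 3 - 6652800 * a * b ^ 5) * l * m ^ 8 : R)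
    + ((-962280 * a ^ 9 - 142560 * a ^ 6 * b ^ 2 + 3822720 * a ^ 3 * b ^ 4 - 2112000 * b ^ 6) * m ^ 9 : R)

set_option maxHeartbeats 4000000 in
/-- Expanded form of a normalised fourth derivative of `bD` (`0` times in `m`). -/
def eP0 {R : Type*} [CommRing R] (a b l m : R) : R :=
    ((-875 * a ^ 3 - 448 * b ^ 2) * l ^ 8 : R)
    + ((-7560 * a ^ 2 * b) * l ^ 7 * m : R)
    + ((-4900 * a ^ 4 - 10976 * a * b ^ 2) * l ^ 6 * m ^ 2 : R)
    + ((-4312 * a ^ 3 * b - 6272 * b ^ 3) * l ^ 5 * m ^ 3 : R)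
    + ((7350 * a ^ 5 + 5880 * a ^ 2 * b ^ 2) * l ^ 4 * m ^ 4 : R)
    + ((20776 * a ^ 4 * b + 10976 * a * b ^ 3) * l ^ 3 * m ^ 5 : R)
    + ((1260 * a ^ 6 + 22960 * a ^ 3 * b ^ 2 + 2240 * b ^ 4) * l ^ 2 * m ^ 6 : R)
    + ((3192 * a ^ 5 * b + 7392 * a ^ 2 * b ^ 3) * l * m ^ 7 : R)
    + ((189 * a ^ 7 + 728 * a ^ 4 * b ^ 2 + 784 * a * b ^ 4) * m ^ 8 : R)

set_option maxHeartbeats 4000000 in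
/-- Expanded form of a normalised fourth derivative of `bD` (`1` times in `m`). -/
def eP1 {R : Type*} [CommRing R] (a b l m : R) : R :=
    ((-945 * a ^ 2 * b) * l ^ 8 : R)
    + ((-1400 * a ^ 4 - 3136 * a * b ^ 2) * l ^ 7 * m : R)
    + ((-2156 * a ^ 3 * b - 3136 * b ^ 3) * l ^ 6 * m ^ 2 : R)
    + ((5880 * a ^ 5 + 4704 * a ^ 2 * b ^ 2) * l ^ 5 * m ^ 3 : R)
    + ((25970 * a ^ 4 * b + 13720 * a * b ^ 3) * l ^ 4 * m ^ 4 : R)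
    + ((2520 * a ^ 6 + 45920 * a ^ 3 * b ^ 2 + 4480 * b ^ 4) * l ^ 3 * m ^ 5 : R)
    + ((11172 * a ^ 5 * b + 25872 * a ^ 2 * b ^ 3) * l ^ 2 * m ^ 6 : R)
    + ((1512 * a ^ 7 + 5824 * a ^ 4 * b ^ 2 + 6272 * a * b ^ 4) * l * m ^ 7 : R)
    + ((567 * a ^ 6 * b + 952 * a ^ 3 * b ^ 3 + 560 * b ^ 5) * m ^ 8 : R)

set_option maxHeartbeats 4000000 in
/-- Expanded form of a normalised fourth derivative of `bD` (`2` times in `m`). -/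
def eP2 {R : Type*} [CommRing R] (a b l m : R) : R :=
    ((-175 * a ^ 4 - 392 * a * b ^ 2) * l ^ 8 : R)
    + ((-616 * a ^ 3 * b - 896 * b ^ 3) * l ^ 7 * m : R)
    + ((2940 * a ^ 5 + 2352 * a ^ 2 * b ^ 2) * l ^ 6 * m ^ 2 : R)
    + ((20776 * a ^ 4 * b + 10976 * a * b ^ 3) * l ^ 5 * m ^ 3 : R)
    + ((3150 * a ^ 6 + 57400 * a ^ 3 * b ^ 2 + 5600 * b ^ 4) * l ^ 4 * m ^ 4 : R)
    + ((22344 * a ^ 5 * b + 51744 * a ^ 2 * b ^ 3) * l ^ 3 * m ^ 5 : R)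
    + ((5292 * a ^ 7 + 20384 * a ^ 4 * b ^ 2 + 21952 * a * b ^ 4) * l ^ 2 * m ^ 6 : R)
    + ((4536 * a ^ 6 * b + 7616 * a ^ 3 * b ^ 3 + 4480 * b ^ 5) * l * m ^ 7 : R)
    + ((-567 * a ^ 8 + 2016 * a ^ 5 * b ^ 2 + 1008 * a ^ 2 * b ^ 4) * m ^ 8 : R)

set_option maxHeartbeats 4000000 in
/-- Expanded form of a normalised fourth derivative of `bD` (`3` times in `m`). -/
def eP3 {R : Type*} [CommRing R] (a b l m : R) : R :=
    ((-77 * a ^ 3 * b - 112 * b ^ 3) * l ^ 8 : R)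
    + ((840 * a ^ 5 + 672 * a ^ 2 * b ^ 2) * l ^ 7 * m : R)
    + ((10388 * a ^ 4 * b + 5488 * a * b ^ 3) * l ^ 6 * m ^ 2 : R)
    + ((2520 * a ^ 6 + 45920 * a ^ 3 * b ^ 2 + 4480 * b ^ 4) * l ^ 5 * m ^ 3 : R)
    + ((27930 * a ^ 5 * b + 64680 * a ^ 2 * b ^ 3) * l ^ 4 * m ^ 4 : R)
    + ((10584 * a ^ 7 + 40768 * a ^ 4 * b ^ 2 + 43904 * a * b ^ 4) * l ^ 3 * m ^ 5 : R)
    + ((15876 * a ^ 6 * b + 26656 * a ^ 3 * b ^ 3 + 15680 * b ^ 5) * l ^ 2 * m ^ 6 : R)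
    + ((-4536 * a ^ 8 + 16128 * a ^ 5 * b ^ 2 + 8064 * a ^ 2 * b ^ 4) * l * m ^ 7 : R)
    + ((-4725 * a ^ 7 * b + 11480 * a ^ 4 * b ^ 3 - 3920 * a * b ^ 5) * m ^ 8 : R)

set_option maxHeartbeats 4000000 in
/-- Expanded form of a normalised fourth derivative of `bD` (`4` times in `m`). -/
def eP4 {R : Type*} [CommRing R] (a b l m : R) : R :=
    ((105 * a ^ 5 + 84 * a ^ 2 * b ^ 2) * l ^ 8 : R)
    + ((2968 * a ^ 4 * b + 1568 * a * b ^ 3) * l ^ 7 * m : R)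
    + ((1260 * a ^ 6 + 22960 * a ^ 3 * b ^ 2 + 2240 * b ^ 4) * l ^ 6 * m ^ 2 : R)
    + ((22344 * a ^ 5 * b + 51744 * a ^ 2 * b ^ 3) * l ^ 5 * m ^ 3 : R)
    + ((13230 * a ^ 7 + 50960 * a ^ 4 * b ^ 2 + 54880 * a * b ^ 4) * l ^ 4 * m ^ 4 : R)
    + ((31752 * a ^ 6 * b + 53312 * a ^ 3 * b ^ 3 + 31360 * b ^ 5) * l ^ 3 * m ^ 5 : R)
    + ((-15876 * a ^ 8 + 56448 * a ^ 5 * b ^ 2 + 28224 * a ^ 2 * b ^ 4) * l ^ 2 * m ^ 6 : R)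
    + ((-37800 * a ^ 7 * b + 91840 * a ^ 4 * b ^ 3 - 31360 * a * b ^ 5) * l * m ^ 7 : R)
    + ((-5103 * a ^ 9 - 756 * a ^ 6 * b ^ 2 + 20272 * a ^ 3 * b ^ 4 - 11200 * b ^ 6) * m ^ 8 : R)

theorem derivation_num {R : Type*} [CommRing R] [Algebra ℚ R] (d : Derivation ℚ R R) (n : ℕ)
    [n.AtLeastTwo] : d (OfNat.ofNat n : R) = 0 :=
  (congrArg _ (Nat.cast_ofNat (n := n)).symm).trans (Derivation.map_natCast _ _)

set_option maxHeartbeats 4000000 in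
theorem d_eD {R : Type*} [CommRing R] [Algebra ℚ R] (d : Derivation ℚ R R) (a b l m : R)
    (ha : d a = 0) (hb : d b = 0) :
    d (eD a b l m) = eDl a b l m * d l + eDm a b l m * d m := by
  have hn : ∀ (n : ℕ) [n.AtLeastTwo], d (OfNat.ofNat n : R) = 0 := fun n _ => derivation_num d n
  unfold eD eDl eDm
  simp only [map_add, map_sub, map_neg, Derivation.leibniz, Derivation.leibniz_pow, hn, ha, hb,
    smul_eq_mul, nsmul_eq_mul, mul_zero, add_zero, zero_add, smul_zero, sub_zero, neg_zero,
    Nat.cast_ofNat]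
  ring

set_option maxHeartbeats 4000000 in
theorem d_eDl {R : Type*} [CommRing R] [Algebra ℚ R] (d : Derivation ℚ R R) (a b l m : R)
    (ha : d a = 0) (hb : d b = 0) :
    d (eDl a b l m) = eDll a b l m * d l + eDlm a b l m * d m := by
  have hn : ∀ (n : ℕ) [n.AtLeastTwo], d (OfNat.ofNat n : R) = 0 := fun n _ => derivation_num d n
  unfold eDl eDll eDlm
  simp only [map_add, map_sub, map_neg, Derivation.leibniz, Derivation.leibniz_pow, hn, ha, hb,
    smul_eq_mul, nsmul_eq_mul, mul_zero, add_zero, zero_add, smul_zero, sub_zero, neg_zero,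
    Nat.cast_ofNat]
  ring

set_option maxHeartbeats 4000000 in
theorem d_eDm {R : Type*} [CommRing R] [Algebra ℚ R] (d : Derivation ℚ R R) (a b l m : R)
    (ha : d a = 0) (hb : d b = 0) :
    d (eDm a b l m) = eDlm a b l m * d l + eDmm a b l m * d m := by
  have hn : ∀ (n : ℕ) [n.AtLeastTwo], d (OfNat.ofNat n : R) = 0 := fun n _ => derivation_num d n
  unfold eDm eDlm eDmm
  simp only [map_add, map_sub, map_neg, Derivation.leibniz, Derivation.leibniz_pow, hn, ha, hb,
    smul_eq_mul, nsmul_eq_mul, mul_zero, add_zero, zero_add, smul_zero, sub_zero, neg_zero,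
    Nat.cast_ofNat]
  ring

set_option maxHeartbeats 4000000 in
theorem d_eDll {R : Type*} [CommRing R] [Algebra ℚ R] (d : Derivation ℚ R R) (a b l m : R)
    (ha : d a = 0) (hb : d b = 0) :
    d (eDll a b l m) = eDlll a b l m * d l + eDllm a b l m * d m := by
  have hn : ∀ (n : ℕ) [n.AtLeastTwo], d (OfNat.ofNat n : R) = 0 := fun n _ => derivation_num d n
  unfold eDll eDlll eDllm
  simp only [map_add, map_sub, map_neg, Derivation.leibniz, Derivation.leibniz_pow, hn, ha, hb,
    smul_eq_mul, nsmul_eq_mul, mul_zero, add_zero, zero_add, smul_zero, sub_zero, neg_zero,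
    Nat.cast_ofNat]
  ring

set_option maxHeartbeats 4000000 in
theorem d_eDlm {R : Type*} [CommRing R] [Algebra ℚ R] (d : Derivation ℚ R R) (a b l m : R)
    (ha : d a = 0) (hb : d b = 0) :
    d (eDlm a b l m) = eDllm a b l m * d l + eDlmm a b l m * d m := by
  have hn : ∀ (n : ℕ) [n.AtLeastTwo], d (OfNat.ofNat n : R) = 0 := fun n _ => derivation_num d n
  unfold eDlm eDllm eDlmm
  simp only [map_add, map_sub, map_neg, Derivation.leibniz, Derivation.leibniz_pow, hn, ha, hb,
    smul_eq_mul, nsmul_eq_mul, mul_zero, add_zero, zero_add, smul_zero, sub_zero, neg_zero,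
    Nat.cast_ofNat]
  ring

set_option maxHeartbeats 4000000 in
theorem d_eDmm {R : Type*} [CommRing R] [Algebra ℚ R] (d : Derivation ℚ R R) (a b l m : R)
    (ha : d a = 0) (hb : d b = 0) :
    d (eDmm a b l m) = eDlmm a b l m * d l + eDmmm a b l m * d m := by
  have hn : ∀ (n : ℕ) [n.AtLeastTwo], d (OfNat.ofNat n : R) = 0 := fun n _ => derivation_num d n
  unfold eDmm eDlmm eDmmm
  simp only [map_add, map_sub, map_neg, Derivation.leibniz, Derivation.leibniz_pow, hn, ha, hb,
    smul_eq_mul, nsmul_eq_mul, mul_zero, add_zero, zero_add, smul_zero, sub_zero, neg_zero,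
    Nat.cast_ofNat]
  ring

theorem pderiv_two_X : pderiv 2 (X 0 : MvPolynomial (Fin 4) ℚ) = 0 ∧
    pderiv 2 (X 1 : MvPolynomial (Fin 4) ℚ) = 0 ∧ pderiv 2 (X 2 : MvPolynomial (Fin 4) ℚ) = 1 ∧
    pderiv 2 (X 3 : MvPolynomial (Fin 4) ℚ) = 0 :=
  ⟨pderiv_X_of_ne (by decide), pderiv_X_of_ne (by decide), pderiv_X_self _,
    pderiv_X_of_ne (by decide)⟩

theorem pderiv_three_X : pderiv 3 (X 0 : MvPolynomial (Fin 4) ℚ) = 0 ∧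
    pderiv 3 (X 1 : MvPolynomial (Fin 4) ℚ) = 0 ∧ pderiv 3 (X 2 : MvPolynomial (Fin 4) ℚ) = 0 ∧
    pderiv 3 (X 3 : MvPolynomial (Fin 4) ℚ) = 1 :=
  ⟨pderiv_X_of_ne (by decide), pderiv_X_of_ne (by decide), pderiv_X_of_ne (by decide),
    pderiv_X_self _⟩

theorem pderiv_eD_2 : pderiv 2 (eD (X 0) (X 1) (X 2) (X 3)) =
    (eDl (X 0) (X 1) (X 2) (X 3) : MvPolynomial (Fin 4) ℚ) := by
  obtain ⟨h0, h1, h2, h3⟩ := pderiv_two_X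
  simp [d_eD _ _ _ _ _ h0 h1, h2, h3]

theorem pderiv_eD_3 : pderiv 3 (eD (X 0) (X 1) (X 2) (X 3)) =
    (eDm (X 0) (X 1) (X 2) (X 3) : MvPolynomial (Fin 4) ℚ) := by
  obtain ⟨h0, h1, h2, h3⟩ := pderiv_three_X
  simp [d_eD _ _ _ _ _ h0 h1, h2, h3]

theorem pderiv_eDl_2 : pderiv 2 (eDl (X 0) (X 1) (X 2) (X 3)) =
    (eDll (X 0) (X 1) (X 2) (X 3) : MvPolynomial (Fin 4) ℚ) := by
  obtain ⟨h0, h1, h2, h3⟩ := pderiv_two_X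
  simp [d_eDl _ _ _ _ _ h0 h1, h2, h3]

theorem pderiv_eDm_2 : pderiv 2 (eDm (X 0) (X 1) (X 2) (X 3)) =
    (eDlm (X 0) (X 1) (X 2) (X 3) : MvPolynomial (Fin 4) ℚ) := by
  obtain ⟨h0, h1, h2, h3⟩ := pderiv_two_X
  simp [d_eDm _ _ _ _ _ h0 h1, h2, h3]

theorem pderiv_eDm_3 : pderiv 3 (eDm (X 0) (X 1) (X 2) (X 3)) =
    (eDmm (X 0) (X 1) (X 2) (X 3) : MvPolynomial (Fin 4) ℚ) := by
  obtain ⟨h0, h1, h2, h3⟩ := pderiv_three_X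
  simp [d_eDm _ _ _ _ _ h0 h1, h2, h3]

theorem pderiv_eDll_2 : pderiv 2 (eDll (X 0) (X 1) (X 2) (X 3)) =
    (eDlll (X 0) (X 1) (X 2) (X 3) : MvPolynomial (Fin 4) ℚ) := by
  obtain ⟨h0, h1, h2, h3⟩ := pderiv_two_X
  simp [d_eDll _ _ _ _ _ h0 h1, h2, h3]

theorem pderiv_eDll_3 : pderiv 3 (eDll (X 0) (X 1) (X 2) (X 3)) =
    (eDllm (X 0) (X 1) (X 2) (X 3) : MvPolynomial (Fin 4) ℚ) := by
  obtain ⟨h0, h1, h2, h3⟩ := pderiv_three_X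
  simp [d_eDll _ _ _ _ _ h0 h1, h2, h3]

theorem pderiv_eDlm_2 : pderiv 2 (eDlm (X 0) (X 1) (X 2) (X 3)) =
    (eDllm (X 0) (X 1) (X 2) (X 3) : MvPolynomial (Fin 4) ℚ) := by
  obtain ⟨h0, h1, h2, h3⟩ := pderiv_two_X
  simp [d_eDlm _ _ _ _ _ h0 h1, h2, h3]

theorem pderiv_eDlm_3 : pderiv 3 (eDlm (X 0) (X 1) (X 2) (X 3)) =
    (eDlmm (X 0) (X 1) (X 2) (X 3) : MvPolynomial (Fin 4) ℚ) := by
  obtain ⟨h0, h1, h2, h3⟩ := pderiv_three_X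
  simp [d_eDlm _ _ _ _ _ h0 h1, h2, h3]

theorem pderiv_eDmm_2 : pderiv 2 (eDmm (X 0) (X 1) (X 2) (X 3)) =
    (eDlmm (X 0) (X 1) (X 2) (X 3) : MvPolynomial (Fin 4) ℚ) := by
  obtain ⟨h0, h1, h2, h3⟩ := pderiv_two_X
  simp [d_eDmm _ _ _ _ _ h0 h1, h2, h3]

theorem pderiv_eDmm_3 : pderiv 3 (eDmm (X 0) (X 1) (X 2) (X 3)) =
    (eDmmm (X 0) (X 1) (X 2) (X 3) : MvPolynomial (Fin 4) ℚ) := by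
  obtain ⟨h0, h1, h2, h3⟩ := pderiv_three_X
  simp [d_eDmm _ _ _ _ _ h0 h1, h2, h3]

set_option maxHeartbeats 4000000 in
theorem eDlll_euler {R : Type*} [CommRing R] (a b l m : R) :
    7 * eDlll a b l m = 1320 * (eP0 a b l m * l + eP1 a b l m * m) := by
  unfold eDlll eP0 eP1
  ring

set_option maxHeartbeats 4000000 in
theorem eDllm_euler {R : Type*} [CommRing R] (a b l m : R) :
    7 * eDllm a b l m = 1320 * (eP1 a b l m * l + eP2 a b l m * m) := by
  unfold eDllm eP1 eP2
  ring

set_option maxHeartbeats 4000000 in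
theorem eDlmm_euler {R : Type*} [CommRing R] (a b l m : R) :
    7 * eDlmm a b l m = 1320 * (eP2 a b l m * l + eP3 a b l m * m) := by
  unfold eDlmm eP2 eP3
  ring

set_option maxHeartbeats 4000000 in
theorem eDmmm_euler {R : Type*} [CommRing R] (a b l m : R) :
    7 * eDmmm a b l m = 1320 * (eP3 a b l m * l + eP4 a b l m * m) := by
  unfold eDmmm eP3 eP4
  ring

set_option maxHeartbeats 4000000 in
theorem eDll_euler {R : Type*} [CommRing R] (a b l m : R) :
    10 * eDll a b l m = eDlll a b l m * l + eDllm a b l m * m := by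
  unfold eDll eDlll eDllm
  ring

set_option maxHeartbeats 4000000 in
theorem eDlm_euler {R : Type*} [CommRing R] (a b l m : R) :
    10 * eDlm a b l m = eDllm a b l m * l + eDlmm a b l m * m := by
  unfold eDlm eDllm eDlmm
  ring

set_option maxHeartbeats 4000000 in
theorem eDmm_euler {R : Type*} [CommRing R] (a b l m : R) :
    10 * eDmm a b l m = eDlmm a b l m * l + eDmmm a b l m * m := by
  unfold eDmm eDlmm eDmmm
  ring

set_option maxHeartbeats 4000000 in
theorem eDl_euler {R : Type*} [CommRing R] (a b l m : R) :
    11 * eDl a b l m = eDll a b l m * l + eDlm a b l m * m := by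
  unfold eDl eDll eDlm
  ring

set_option maxHeartbeats 4000000 in
theorem eDm_euler {R : Type*} [CommRing R] (a b l m : R) :
    11 * eDm a b l m = eDlm a b l m * l + eDmm a b l m * m := by
  unfold eDm eDlm eDmm
  ring

set_option maxHeartbeats 4000000 in
theorem eD_euler {R : Type*} [CommRing R] (a b l m : R) :
    12 * eD a b l m = eDl a b l m * l + eDm a b l m * m := by
  unfold eD eDl eDm
  ring

/-- The apolarity invariant of the fourth derivatives vanishes. -/
theorem eI_rel {R : Type*} [CommRing R] (a b l m : R) :
    eP0 a b l m * eP4 a b l m - 4 * eP1 a b l m * eP3 a b l m + 3 * eP2 a b l m ^ 2 = 0 := by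
  unfold eP0 eP1 eP2 eP3 eP4
  ring

set_option maxHeartbeats 40000000 in
set_option maxRecDepth 10000 in
/-- The catalecticant of the fourth derivatives. -/
theorem eJ_rel {R : Type*} [CommRing R] (a b l m : R) :
    eP0 a b l m * eP2 a b l m * eP4 a b l m + 2 * eP1 a b l m * eP2 a b l m * eP3 a b l m
      - eP0 a b l m * eP3 a b l m ^ 2 - eP1 a b l m ^ 2 * eP4 a b l m - eP2 a b l m ^ 3
      = 1372 * (a ^ 3 - b ^ 2) ^ 2 * eD a b l m ^ 2 := by
  unfold eP0 eP1 eP2 eP3 eP4 eD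
  ring

set_option maxHeartbeats 4000000 in
/-- Syzygy of the covariants of a binary quartic. -/
theorem quartic_syzygy {R : Type*} [CommRing R] (p0 p1 p2 p3 p4 l m a0 a1 a2 a3 A B C U V F : R)
    (h0 : a0 = p0 * l + p1 * m) (h1 : a1 = p1 * l + p2 * m) (h2 : a2 = p2 * l + p3 * m)
    (h3 : a3 = p3 * l + p4 * m) (hA : A = a0 * l + a1 * m) (hB : B = a1 * l + a2 * m)
    (hC : C = a2 * l + a3 * m) (hU : U = A * l + B * m) (hV : V = B * l + C * m)
    (hF : F = U * l + V * m) :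
    (U * (a1 * C + A * a3 - 2 * B * a2) - V * (a0 * C + A * a2 - 2 * B * a1)) ^ 2
      + 4 * (A * C - B ^ 2) ^ 3
      = F ^ 2 * ((p0 * p4 - 4 * p1 * p3 + 3 * p2 ^ 2) * (A * C - B ^ 2)
        - F * (p0 * p2 * p4 + 2 * p1 * p2 * p3 - p0 * p3 ^ 2 - p1 ^ 2 * p4 - p2 ^ 3)) := by
  subst h0 h1 h2 h3 hA hB hC hU hV hF
  ring

theorem bD_eq : bD = eD (X 0) (X 1) (X 2) (X 3) := by
  unfold bD eD
  ring

/-- The algebraic part of the argument: Euler's relations, apolarity and the value of the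
catalecticant imply the identity. -/
theorem algebraic_core {R : Type*} [CommRing R] [IsDomain R] [CharZero R]
    (p0 p1 p2 p3 p4 l m D Dl Dm Dll Dlm Dmm Dlll Dllm Dlmm Dmmm C4 C4l C4m C6 d : R)
    (e0 : 7 * Dlll = 1320 * (p0 * l + p1 * m)) (e1 : 7 * Dllm = 1320 * (p1 * l + p2 * m))
    (e2 : 7 * Dlmm = 1320 * (p2 * l + p3 * m)) (e3 : 7 * Dmmm = 1320 * (p3 * l + p4 * m))
    (ell : 10 * Dll = Dlll * l + Dllm * m) (elm : 10 * Dlm = Dllm * l + Dlmm * m)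
    (emm : 10 * Dmm = Dlmm * l + Dmmm * m)
    (el : 11 * Dl = Dll * l + Dlm * m) (em : 11 * Dm = Dlm * l + Dmm * m)
    (eF : 12 * D = Dl * l + Dm * m)
    (hC4 : 17424 * C4 = -(Dll * Dmm - Dlm ^ 2))
    (hC4l : 17424 * C4l = -(Dlll * Dmm + Dll * Dlmm - 2 * Dlm * Dllm))
    (hC4m : 17424 * C4m = -(Dllm * Dmm + Dll * Dmmm - 2 * Dlm * Dlmm))
    (hC6 : 240 * C6 = -(Dl * C4m - Dm * C4l))
    (hI : p0 * p4 - 4 * p1 * p3 + 3 * p2 ^ 2 = 0)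
    (hJ : p0 * p2 * p4 + 2 * p1 * p2 * p3 - p0 * p3 ^ 2 - p1 ^ 2 * p4 - p2 ^ 3
      = 1372 * d ^ 2 * D ^ 2) :
    C4 ^ 3 - C6 ^ 2 = d ^ 2 * D ^ 5 := by
  obtain ⟨a0, h0⟩ : ∃ x, x = p0 * l + p1 * m := ⟨_, rfl⟩
  obtain ⟨a1, h1⟩ : ∃ x, x = p1 * l + p2 * m := ⟨_, rfl⟩
  obtain ⟨a2, h2⟩ : ∃ x, x = p2 * l + p3 * m := ⟨_, rfl⟩
  obtain ⟨a3, h3⟩ : ∃ x, x = p3 * l + p4 * m := ⟨_, rfl⟩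
  obtain ⟨A, hA⟩ : ∃ x, x = a0 * l + a1 * m := ⟨_, rfl⟩
  obtain ⟨B, hB⟩ : ∃ x, x = a1 * l + a2 * m := ⟨_, rfl⟩
  obtain ⟨C, hC⟩ : ∃ x, x = a2 * l + a3 * m := ⟨_, rfl⟩
  obtain ⟨U, hU⟩ : ∃ x, x = A * l + B * m := ⟨_, rfl⟩
  obtain ⟨V, hV⟩ : ∃ x, x = B * l + C * m := ⟨_, rfl⟩
  obtain ⟨F, hF⟩ : ∃ x, x = U * l + V * m := ⟨_, rfl⟩
  have key := quartic_syzygy p0 p1 p2 p3 p4 l m a0 a1 a2 a3 A B C U V F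
    h0 h1 h2 h3 hA hB hC hU hV hF
  rw [hI, hJ] at key
  rw [← h0] at e0
  rw [← h1] at e1
  rw [← h2] at e2
  rw [← h3] at e3
  clear h0 h1 h2 h3 hI hJ
  have n10 : (10 : R) ≠ 0 := by norm_num
  have n11 : (11 : R) ≠ 0 := by norm_num
  have n12 : (12 : R) ≠ 0 := by norm_num
  have fll : 7 * Dll = 132 * A := mul_left_cancel₀ n10 (by
    linear_combination 7 * ell + l * e0 + m * e1 - 1320 * hA)
  have flm : 7 * Dlm = 132 * B := mul_left_cancel₀ n10 (by
    linear_combination 7 * elm + l * e1 + m * e2 - 1320 * hB)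
  have fmm : 7 * Dmm = 132 * C := mul_left_cancel₀ n10 (by
    linear_combination 7 * emm + l * e2 + m * e3 - 1320 * hC)
  have fl : 7 * Dl = 12 * U := mul_left_cancel₀ n11 (by
    linear_combination 7 * el + l * fll + m * flm - 132 * hU)
  have fm : 7 * Dm = 12 * V := mul_left_cancel₀ n11 (by
    linear_combination 7 * em + l * flm + m * fmm - 132 * hV)
  have fF : 7 * D = F := mul_left_cancel₀ n12 (by
    linear_combination 7 * eF + l * fl + m * fm - 12 * hF)
  have n1 : (17424 : R) ≠ 0 := by norm_num
  have g4 : 49 * C4 = -(A * C - B ^ 2) := mul_left_cancel₀ n1 (by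
    linear_combination 49 * hC4 - 7 * Dmm * fll - 132 * A * fmm + (7 * Dlm + 132 * B) * flm)
  have g4l : 49 * C4l = -10 * (a0 * C + A * a2 - 2 * B * a1) := mul_left_cancel₀ n1 (by
    linear_combination 49 * hC4l - 7 * Dmm * e0 - 1320 * a0 * fmm - 7 * Dlmm * fll
      - 132 * A * e2 + 2 * (7 * Dllm) * flm + 2 * 132 * B * e1)
  have g4m : 49 * C4m = -10 * (a1 * C + A * a3 - 2 * B * a2) := mul_left_cancel₀ n1 (by
    linear_combination 49 * hC4m - 7 * Dmm * e1 - 1320 * a1 * fmm - 7 * Dmmm * fll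
      - 132 * A * e3 + 2 * (7 * Dlmm) * flm + 2 * 132 * B * e2)
  have n2 : (120 : R) ≠ 0 := by norm_num
  have g6 : 686 * C6 = U * (a1 * C + A * a3 - 2 * B * a2) - V * (a0 * C + A * a2 - 2 * B * a1) :=
    mul_left_cancel₀ n2 (by
      linear_combination 343 * hC6 - 49 * C4m * fl - 12 * U * g4m + 49 * C4l * fm + 12 * V * g4l)
  have g4' : A * C - B ^ 2 = -(49 * C4) := by rw [g4]; ring
  rw [← g6, g4', ← fF] at key
  have n3 : (470596 : R) ≠ 0 := by norm_num
  refine mul_left_cancel₀ n3 ?_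
  linear_combination -key

theorem bC4_rel : 17424 * bC4 = -(eDll (X 0) (X 1) (X 2) (X 3) * eDmm (X 0) (X 1) (X 2) (X 3)
    - eDlm (X 0) (X 1) (X 2) (X 3) ^ 2) := by
  rw [bC4, bD_eq, pderiv_eD_2, pderiv_eD_3, pderiv_eDl_2, pderiv_eDm_2, pderiv_eDm_3,
    show (17424 : MvPolynomial (Fin 4) ℚ) = C (17424 : ℚ) from (map_ofNat C _).symm,
    ← mul_assoc, ← C_mul,
    show (17424 * (-(1 / (11 ^ 2 * 12 ^ 2))) : ℚ) = -1 by norm_num, C_neg, C_1]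
  ring

theorem bC4_rel_l : 17424 * pderiv 2 bC4 =
    -(eDlll (X 0) (X 1) (X 2) (X 3) * eDmm (X 0) (X 1) (X 2) (X 3)
      + eDll (X 0) (X 1) (X 2) (X 3) * eDlmm (X 0) (X 1) (X 2) (X 3)
      - 2 * eDlm (X 0) (X 1) (X 2) (X 3) * eDllm (X 0) (X 1) (X 2) (X 3)) := by
  have h := congrArg (pderiv 2) bC4_rel
  have hn : pderiv 2 (17424 : MvPolynomial (Fin 4) ℚ) = 0 := derivation_num _ _
  simp only [map_neg, map_sub, Derivation.leibniz, Derivation.leibniz_pow, hn, pderiv_eDll_2,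
    pderiv_eDmm_2, pderiv_eDlm_2, smul_eq_mul, nsmul_eq_mul, Nat.cast_ofNat] at h
  linear_combination h

theorem bC4_rel_m : 17424 * pderiv 3 bC4 =
    -(eDllm (X 0) (X 1) (X 2) (X 3) * eDmm (X 0) (X 1) (X 2) (X 3)
      + eDll (X 0) (X 1) (X 2) (X 3) * eDmmm (X 0) (X 1) (X 2) (X 3)
      - 2 * eDlm (X 0) (X 1) (X 2) (X 3) * eDlmm (X 0) (X 1) (X 2) (X 3)) := by
  have h := congrArg (pderiv 3) bC4_rel
  have hn : pderiv 3 (17424 : MvPolynomial (Fin 4) ℚ) = 0 := derivation_num _ _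
  simp only [map_neg, map_sub, Derivation.leibniz, Derivation.leibniz_pow, hn, pderiv_eDll_3,
    pderiv_eDmm_3, pderiv_eDlm_3, smul_eq_mul, nsmul_eq_mul, Nat.cast_ofNat] at h
  linear_combination h

theorem bC6_rel : 240 * bC6 = -(eDl (X 0) (X 1) (X 2) (X 3) * pderiv 3 bC4
    - eDm (X 0) (X 1) (X 2) (X 3) * pderiv 2 bC4) := by
  rw [bC6, bD_eq, pderiv_eD_2, pderiv_eD_3,
    show (240 : MvPolynomial (Fin 4) ℚ) = C (240 : ℚ) from (map_ofNat C _).symm,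
    ← mul_assoc, ← C_mul,
    show (240 * (-(1 / (12 * 20))) : ℚ) = -1 by norm_num, C_neg, C_1]
  ring

/-- In `ℚ[c4, c6, λ, μ]` the identity `𝐂₄³ - 𝐂₆² = (c4³ - c6²)² 𝐃⁵` holds. -/
theorem bC4_cubed_sub_bC6_sq :
    bC4 ^ 3 - bC6 ^ 2 = (X 0 ^ 3 - X 1 ^ 2) ^ 2 * bD ^ 5 := by
  rw [bD_eq]
  exact algebraic_core _ _ _ _ _ (X 2) (X 3) _ _ _ _ _ _ _ _ _ _ _ _ _ _ _
    (eDlll_euler _ _ _ _) (eDllm_euler _ _ _ _) (eDlmm_euler _ _ _ _) (eDmmm_euler _ _ _ _)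
    (eDll_euler _ _ _ _) (eDlm_euler _ _ _ _) (eDmm_euler _ _ _ _)
    (eDl_euler _ _ _ _) (eDm_euler _ _ _ _) (eD_euler _ _ _ _)
    bC4_rel bC4_rel_l bC4_rel_m bC6_rel (eI_rel _ _ _ _) (eJ_rel _ _ _ _)
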